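/- arXiv:math/0104086 — 6 statements merged into one kernel-verified Lean document; each statement's English description precedes it below -/
import Mathlib

section
/- Let p be a prime, e ≥ 1, and suppose q = p^e = x^2 + x + a where x is a positive integer, a = 1 or a = 3, and a ≤ x. If p divides m = 2x + 1, then q = 3. -/
/-- Proposition 4.1: If `q = p^e = x^2 + x + a` with `a = 1` or `a = 3`,
`a ≤ x`, `x > 0`, and the prime `p` divides `m = 2x + 1`, then `q = 3`. -/
theorem prop_4_1 (p e q x a : ℕ) (hp : p.Prime) (he : 1 ≤ e) (hq : q = p ^ e)
    (hx : 0 < x) (ha : a = 1 ∨ a = 3) (hax : a ≤ x) (hqx : q = x ^ 2 + x + a)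
    (hdvd : p ∣ 2 * x + 1) : q = 3 := by
  have key : 4 * q = (2 * x + 1) ^ 2 + (4 * a - 1) := by
    rcases ha with rfl | rfl <;> rw [hqx] <;> ring
  have hpd : p ∣ 4 * a - 1 := by
    refine (Nat.dvd_add_right (dvd_pow hdvd two_ne_zero)).mp (key ▸ Dvd.dvd.mul_left ?_ 4)
    exact hq ▸ dvd_pow_self p (by omega)
  have hpa : p = 4 * a - 1 := by
    refine (Nat.prime_dvd_prime_iff_eq hp ?_).mp hpd
    rcases ha with rfl | rfl <;> norm_num
  have he1 : e = 1 := by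
    by_contra hne
    have hsq : p ^ 2 ∣ 4 * a - 1 := by
      refine (Nat.dvd_add_right (pow_dvd_pow_of_dvd hdvd 2)).mp (key ▸ Dvd.dvd.mul_left ?_ 4)
      exact hq ▸ pow_dvd_pow p (by omega)
    rw [← hpa] at hsq
    have hle := Nat.le_of_dvd hp.pos hsq
    nlinarith [hp.two_le]
  rw [he1, pow_one] at hq
  rcases ha with rfl | rfl
  · omega
  · nlinarith
end

section
/- Let p be a prime with p ≠ 5, let e ≥ 1, and suppose q = p^e = x^2 + x + a where x is a positive integer, a = 1 or a = 3, a ≤ x, and q ≠ 343. Then p does not divide m − 2 = 2x − 1. -/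
/-- One step of the orbit of multiplication by `A + B√d`, on coordinates modulo `M`. -/
def pellStep (d A B M : ℤ) (v : ℤ × ℤ) : ℤ × ℤ :=
  ((A * v.1 + d * B * v.2) % M, (B * v.1 + A * v.2) % M)

/-- A power of `b` beyond `b ^ j` agrees modulo `M` with one of the first `T` such powers,
if these powers have period `T`. -/
theorem exists_lt_pow_emod_eq {b M : ℤ} {j T : ℕ} (hT : 0 < T)
    (h : b ^ (j + T) % M = b ^ j % M) {k : ℕ} (hk : j ≤ k) :
    ∃ i < T, b ^ k % M = b ^ (j + i) % M := by
  induction k, hk using Nat.le_induction with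
  | base => exact ⟨0, hT, rfl⟩
  | succ k _ ih =>
    obtain ⟨i, hi, hki⟩ := ih
    have hs : b ^ (k + 1) % M = b ^ (j + (i + 1)) % M := by
      rw [pow_succ, Int.mul_emod, hki, ← Int.mul_emod, ← pow_succ, add_assoc]
    rcases Nat.lt_or_ge (i + 1) T with hiT | hiT
    · exact ⟨i + 1, hiT, hs⟩
    · obtain rfl : i + 1 = T := by omega
      exact ⟨0, hT, hs.trans h⟩

/-- The solutions of `Y² + 11 = 12z²` with `Y ≡ 2 [ZMOD 3]` reduce modulo `27 * 433` to
elements of a periodic orbit. -/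
theorem exists_orbit_of_sq_add_eleven (n : ℕ) : ∀ Y z : ℤ, 0 < z → z ≤ n → (0 < Y ∨ z = 1) →
    Y % 3 = 2 → Y ^ 2 + 11 = 12 * z ^ 2 →
    ∃ i < 108, (Y % 11691, z % 11691) = (pellStep 12 7 2 11691)^[i] (11690, 1) := by
  induction n with
  | zero => intro Y z hz hzn; omega
  | succ n ih =>
    intro Y z hz hzn hYz hY h
    by_cases h1 : z = 1
    · subst h1
      have : Y = -1 := by
        have h2 : Y ≤ 1 := by nlinarith
        have h3 : -1 ≤ Y := by nlinarith
        omega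
      subst this
      exact ⟨0, by norm_num, by decide⟩
    have hY0 : 0 < Y := by omega
    have hz1 : 2 ≤ z := by omega
    have hzY : 3 * z < Y := by nlinarith
    have hzY' : 2 * Y < 7 * z := by nlinarith
    have hprev : 0 < 7 * Y - 24 * z ∨ 7 * z - 2 * Y = 1 := by
      rcases le_or_gt z 6 with h6 | h6
      · have hY' : Y ≤ 20 := by omega
        interval_cases z <;> interval_cases Y <;> omega
      · left; nlinarith
    obtain ⟨i, hi, he⟩ := ih (7 * Y - 24 * z) (7 * z - 2 * Y) (by omega)
      (by push_cast at hzn; omega) hprev (by omega) (by linear_combination h)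
    have hs : (Y % 11691, z % 11691) = (pellStep 12 7 2 11691)^[i + 1] (11690, 1) := by
      rw [Function.iterate_succ_apply', ← he, pellStep]
      ext <;> dsimp only <;> omega
    rcases Nat.lt_or_ge (i + 1) 108 with hi' | hi'
    · exact ⟨i + 1, hi', hs⟩
    · obtain rfl : i = 107 := by omega
      exact ⟨0, by norm_num, hs.trans (by decide +kernel)⟩

theorem sq_add_eleven_ne_twelve_mul_three_pow_sq {Y : ℤ} {k : ℕ} (hY0 : 0 < Y) (hY : Y % 3 = 2)
    (hk : 3 ≤ k) : Y ^ 2 + 11 ≠ 12 * (3 ^ k) ^ 2 := by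
  intro h
  obtain ⟨i, hi, hYz⟩ := exists_orbit_of_sq_add_eleven (3 ^ k) Y (3 ^ k) (by positivity)
    (by push_cast; rfl) (.inl hY0) hY h
  obtain ⟨l, hl, hkl⟩ := exists_lt_pow_emod_eq (b := 3) (M := 11691) (j := 3) (T := 27)
    (by norm_num) (by norm_num) hk
  have hne : ∀ i < 108, ((pellStep 12 7 2 11691)^[i] (11690, 1)).2 % 27 = 0 → ∀ l < 27,
      ((pellStep 12 7 2 11691)^[i] (11690, 1)).2 ≠ 3 ^ (3 + l) % 11691 := by
    decide +kernel
  have hz : ((pellStep 12 7 2 11691)^[i] (11690, 1)).2 = 3 ^ (3 + l) % 11691 := by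
    rw [← hYz, ← hkl]
  refine hne i hi ?_ l hl hz
  rw [hz, pow_add]
  omega

/-- The solutions of `Y² + 3 = 28z²` with `Y ≡ 2 [ZMOD 7]` reduce modulo `49 * 1373` to
elements of a periodic orbit. -/
theorem exists_orbit_of_sq_add_three (n : ℕ) : ∀ Y z : ℤ, 0 < z → z ≤ n → (0 < Y ∨ z = 1) →
    Y % 7 = 2 → Y ^ 2 + 3 = 28 * z ^ 2 →
    ∃ i < 98, (Y % 67277, z % 67277) = (pellStep 28 127 24 67277)^[i] (67272, 1) := by
  induction n with
  | zero => intro Y z hz hzn; omega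
  | succ n ih =>
    intro Y z hz hzn hYz hY h
    by_cases h1 : z = 1
    · subst h1
      have : Y = -5 := by
        have h2 : Y ≤ 5 := by nlinarith
        have h3 : -5 ≤ Y := by nlinarith
        interval_cases Y <;> omega
      subst this
      exact ⟨0, by norm_num, by decide⟩
    have hY0 : 0 < Y := by omega
    have hz1 : 2 ≤ z := by omega
    have hz2 : z ≠ 2 := by
      rintro rfl
      have : Y ≤ 10 := by nlinarith
      interval_cases Y <;> omega
    have hz3 : 3 ≤ z := by omega
    have hzY : 21 * z < 4 * Y := by nlinarith
    have hzY' : 24 * Y < 127 * z := by nlinarith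
    have hprev : 0 < 127 * Y - 672 * z ∨ 127 * z - 24 * Y = 1 := by
      rcases le_or_gt z 41 with h41 | h41
      · have hsmall : ∀ z < 42, ∀ Y < 218, Y ^ 2 + 3 = 28 * z ^ 2 → Y % 7 = 2 →
            127 * z = 24 * Y + 1 := by
          decide +kernel
        lift z to ℕ using hz.le
        lift Y to ℕ using hY0.le
        have := hsmall z (by omega) Y (by omega) (by exact_mod_cast h) (by omega)
        omega
      · left; nlinarith
    obtain ⟨i, hi, he⟩ := ih (127 * Y - 672 * z) (127 * z - 24 * Y) (by omega)
      (by push_cast at hzn; omega) hprev (by omega) (by linear_combination h)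
    have hs : (Y % 67277, z % 67277) = (pellStep 28 127 24 67277)^[i + 1] (67272, 1) := by
      rw [Function.iterate_succ_apply', ← he, pellStep]
      ext <;> dsimp only <;> omega
    rcases Nat.lt_or_ge (i + 1) 98 with hi' | hi'
    · exact ⟨i + 1, hi', hs⟩
    · obtain rfl : i = 97 := by omega
      exact ⟨0, by norm_num, hs.trans (by decide +kernel)⟩

theorem sq_add_three_ne_twentyEight_mul_seven_pow_sq {Y : ℤ} {k : ℕ} (hY0 : 0 < Y)
    (hY : Y % 7 = 2) (hk : 2 ≤ k) : Y ^ 2 + 3 ≠ 28 * (7 ^ k) ^ 2 := by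
  intro h
  obtain ⟨i, hi, hYz⟩ := exists_orbit_of_sq_add_three (7 ^ k) Y (7 ^ k) (by positivity)
    (by push_cast; rfl) (.inl hY0) hY h
  obtain ⟨l, hl, hkl⟩ := exists_lt_pow_emod_eq (b := 7) (M := 67277) (j := 2) (T := 343)
    (by norm_num) (by decide +kernel) hk
  have hne : ∀ i < 98, ((pellStep 28 127 24 67277)^[i] (67272, 1)).2 % 49 = 0 → ∀ l < 343,
      ((pellStep 28 127 24 67277)^[i] (67272, 1)).2 ≠ 7 ^ (2 + l) % 67277 := by
    decide +kernel
  have hz : ((pellStep 28 127 24 67277)^[i] (67272, 1)).2 = 7 ^ (2 + l) % 67277 := by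
    rw [← hYz, ← hkl]
  refine hne i hi ?_ l hl hz
  rw [hz, pow_add]
  omega

/-- Proposition 4.2: If `q = p^e = x^2 + x + a` with `a = 1` or `a = 3`,
`a ≤ x`, `x > 0`, `p ≠ 5` and `q ≠ 343`, then `p` does not divide
`m - 2 = 2x - 1`. -/
theorem prop_4_2 (p e q x a : ℕ) (hp : p.Prime) (hp5 : p ≠ 5) (he : 1 ≤ e)
    (hq : q = p ^ e) (hx : 0 < x) (ha : a = 1 ∨ a = 3) (hax : a ≤ x)
    (hqx : q = x ^ 2 + x + a) (hq343 : q ≠ 343) : ¬ p ∣ 2 * x - 1 := by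
  intro hdvd
  have hpq : p ∣ q := hq ▸ dvd_pow_self p (by omega)
  have hpa : p ∣ 4 * a + 3 := by
    obtain ⟨y, rfl⟩ : ∃ y, x = y + 1 := ⟨x - 1, by omega⟩
    have h1 : p ∣ 2 * y + 1 := by convert hdvd using 1; omega
    refine (Nat.dvd_add_right (h1.mul_right (2 * y + 5))).1 ?_
    rw [show (2 * y + 1) * (2 * y + 5) + (4 * a + 3) = 4 * q by rw [hqx]; ring]
    exact hpq.mul_left 4
  subst hq
  rcases ha with rfl | rfl
  · obtain rfl : p = 7 := (Nat.prime_dvd_prime_iff_eq hp (by norm_num)).1 hpa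
    obtain ⟨k, rfl | rfl⟩ := e.even_or_odd'
    · rw [mul_comm, pow_mul] at hqx
      have h1 : x < 7 ^ k := lt_of_pow_lt_pow_left₀ 2 (by positivity) (by omega)
      nlinarith
    · rcases Nat.lt_or_ge k 2 with hk | hk
      · interval_cases k
        · norm_num at hqx
          have : x ≤ 2 := by nlinarith
          interval_cases x <;> omega
        · norm_num at hq343
      · refine sq_add_three_ne_twentyEight_mul_seven_pow_sq (Y := 2 * x + 1) (by omega)
          (by omega) hk ?_
        zify at hqx
        rw [← pow_mul, mul_comm k 2]
        rw [pow_succ] at hqx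
        linear_combination -4 * hqx
  · obtain rfl : p = 3 := by
      have : p ∣ 3 * 5 := hpa
      rcases hp.dvd_mul.1 this with h | h
      · exact (Nat.prime_dvd_prime_iff_eq hp (by norm_num)).1 h
      · exact absurd ((Nat.prime_dvd_prime_iff_eq hp (by norm_num)).1 h) hp5
    obtain ⟨k, rfl | rfl⟩ := e.even_or_odd'
    · rw [mul_comm, pow_mul] at hqx
      have h1 : x < 3 ^ k := lt_of_pow_lt_pow_left₀ 2 (by positivity) (by omega)
      nlinarith
    · rcases Nat.lt_or_ge k 3 with hk | hk
      · have hx15 : x ≤ 15 := by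
          have : 3 ^ (2 * k + 1) ≤ 3 ^ 5 := Nat.pow_le_pow_right (by norm_num) (by omega)
          nlinarith
        interval_cases k <;> interval_cases x <;> omega
      · refine sq_add_eleven_ne_twelve_mul_three_pow_sq (Y := 2 * x + 1) (by omega)
          (by omega) hk ?_
        zify at hqx
        rw [← pow_mul, mul_comm k 2]
        rw [pow_succ] at hqx
        linear_combination -4 * hqx
end

section
/- If e is a positive odd integer and x is a nonnegative integer with 3^e = x^2 + x + 3, then 3^e = 3 or 3^e = 243. -/
/-- The ring `ℤ[α]` with `α ^ 2 = α - 3`, that is `α = (1 + √-11) / 2`. -/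
abbrev IntegersSqrtNegEleven := QuadraticAlgebra ℤ (-3) 1

namespace IntegersSqrtNegEleven

open QuadraticAlgebra

/-- The element `(1 + √-11) / 2`, of norm `3`. -/
def α : IntegersSqrtNegEleven := ⟨0, 1⟩

/-- The element `(1 - √-11) / 2`, the conjugate of `α`. -/
def β : IntegersSqrtNegEleven := ⟨1, -1⟩

theorem α_mul_β : α * β = 3 := by
  ext <;> simp [α, β]

theorem α_pow_four : α ^ 4 = 5 * β + 1 := by
  ext <;> simp [α, β, pow_succ]

theorem eq_α_pow_or_eq_neg_α_pow (e : ℕ) (a b : ℤ) (h : a ^ 2 + a * b + 3 * b ^ 2 = 3 ^ (e + 1))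
    (ha : 3 ∣ a) (hb : ¬ 3 ∣ b) :
    (⟨a, b⟩ : IntegersSqrtNegEleven) = α ^ (e + 1) ∨
      (⟨a, b⟩ : IntegersSqrtNegEleven) = -α ^ (e + 1) := by
  induction e generalizing a b with
  | zero =>
    obtain ⟨k, rfl⟩ := ha
    have hk : k = 0 := by
      have h1 : 3 * k ^ 2 + k * b + b ^ 2 = 1 := by
        rw [zero_add, pow_one] at h
        linarith
      have : k ^ 2 < 1 := by nlinarith [sq_nonneg (k + 2 * b)]
      exact (pow_eq_zero_iff two_ne_zero).mp (by linarith [sq_nonneg k])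
    subst hk
    have hb' : b = 1 ∨ b = -1 := by
      rw [zero_add, pow_one] at h
      exact sq_eq_one_iff.mp (by linarith)
    rcases hb' with rfl | rfl
    · left; ext <;> simp [α]
    · right; ext <;> simp [α]
  | succ e ih =>
    obtain ⟨k, rfl⟩ := ha
    have hnorm : (b + k) ^ 2 + (b + k) * (-k) + 3 * (-k) ^ 2 = 3 ^ (e + 1) := by
      rw [pow_succ _ (e + 1)] at h
      linarith
    have hdvd : (3 : ℤ) ∣ b * (b + k) := by
      have : b * (b + k) = 3 * (3 ^ e - k ^ 2) := by
        rw [pow_succ (3 : ℤ)] at hnorm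
        linarith
      exact ⟨_, this⟩
    have hc : (3 : ℤ) ∣ b + k := (Int.prime_three.dvd_or_dvd hdvd).resolve_left hb
    have hfac : (⟨3 * k, b⟩ : IntegersSqrtNegEleven) = α * ⟨b + k, -k⟩ := by
      ext <;> simp [α]
    rw [hfac, pow_succ' _ (e + 1)]
    rcases ih (b + k) (-k) hnorm hc (by omega) with h | h <;> rw [h]
    · exact Or.inl rfl
    · exact Or.inr (mul_neg _ _)

theorem im_α_pow_of_three_pow_eq {e x : ℕ} (he : 0 < e) (h : 3 ^ e = x ^ 2 + x + 3) :
    (α ^ e).im = 1 ∨ (α ^ e).im = -1 := by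
  obtain ⟨e, rfl⟩ : ∃ k, e = k + 1 := ⟨e - 1, by omega⟩
  have h' : (3 : ℤ) ^ (e + 1) = x ^ 2 + x + 3 := by exact_mod_cast h
  have hdvd : (3 : ℤ) ∣ x * (x + 1) := ⟨3 ^ e - 1, by rw [pow_succ] at h'; linarith⟩
  rcases Int.prime_three.dvd_or_dvd hdvd with hx | hx
  · rcases eq_α_pow_or_eq_neg_α_pow e x 1 (by linarith) hx (by norm_num) with h | h
    · left; rw [← h]
    · right; rw [← neg_eq_iff_eq_neg.mpr h]; rfl
  · rcases eq_α_pow_or_eq_neg_α_pow e (x + 1) (-1) (by linarith) hx (by norm_num) with h | h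
    · right; rw [← h]
    · left; rw [← neg_eq_iff_eq_neg.mpr h]; rfl

theorem im_α_pow_modEq (m r : ℕ) : (α ^ (4 * m + r)).im ≡ (α ^ r).im [ZMOD 5] := by
  induction m with
  | zero => simp
  | succ m ih =>
    have hstep : α ^ (4 * (m + 1) + r) = (5 : ℤ) • (β * α ^ (4 * m + r)) + α ^ (4 * m + r) := by
      rw [show 4 * (m + 1) + r = 4 + (4 * m + r) by ring, pow_add, α_pow_four, zsmul_eq_mul]
      push_cast
      ring
    refine Int.ModEq.trans ?_ ih
    rw [hstep, im_add, im_smul]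
    exact Int.modEq_iff_dvd.mpr ⟨-(β * α ^ (4 * m + r)).im, by
      rw [smul_eq_mul]; ring⟩

theorem im_α_pow_eq_sum (n : ℕ) : (α ^ (4 * (n + 2) + 1)).im = 1 +
    75 * ∑ i ∈ Finset.range (n + 1), 5 ^ i * ((n + 2).choose (i + 2) : ℤ) * (β ^ (i + 1)).im := by
  have hterm (i : ℕ) : α * ((5 * β) ^ (i + 2) * 1 ^ (n + 2 - (i + 2)) * ((n + 2).choose (i + 2))) =
      (75 * (5 ^ i * ((n + 2).choose (i + 2) : ℤ))) • β ^ (i + 1) := by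
    rw [zsmul_eq_mul]
    push_cast
    linear_combination (25 * 5 ^ i * β ^ (i + 1) * ((n + 2).choose (i + 2))) * α_mul_β
  have hexp : α ^ (4 * (n + 2) + 1) = α + (15 * (n + 2 : ℤ) : IntegersSqrtNegEleven) +
      ∑ i ∈ Finset.range (n + 1),
        (75 * (5 ^ i * ((n + 2).choose (i + 2) : ℤ))) • β ^ (i + 1) := by
    rw [pow_succ', pow_mul, α_pow_four, add_pow, Finset.sum_range_succ', Finset.sum_range_succ',
      mul_add, mul_add, Finset.mul_sum, Finset.sum_congr rfl fun i _ => hterm i]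
    simp only [Nat.choose_one_right, Nat.choose_zero_right, one_pow, zero_add, pow_one, pow_zero]
    push_cast
    linear_combination (5 * ((n : IntegersSqrtNegEleven) + 2)) * α_mul_β
  have hconst : (15 * (n + 2 : ℤ) : IntegersSqrtNegEleven).im = 0 := by simp
  have hsum := map_sum (imₗ (R := ℤ) (-3) 1)
    (fun i => (75 * (5 ^ i * ((n + 2).choose (i + 2) : ℤ))) • β ^ (i + 1)) (Finset.range (n + 1))
  simp only [imₗ, LinearMap.coe_mk, AddHom.coe_mk] at hsum
  rw [hexp, im_add, im_add, hconst, hsum, Finset.mul_sum, add_zero]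
  simp only [α, im_smul, smul_eq_mul, mul_assoc]

end IntegersSqrtNegEleven

theorem not_five_pow_dvd_mul (i : ℕ) : ¬ 5 ^ (i + 1) ∣ (i + 2) * (i + 3) := by
  rcases i with _ | i
  · norm_num
  · have hlt : (i + 1 + 2) * (i + 1 + 3) < 5 ^ (i + 1 + 1) := by
      induction i with
      | zero => norm_num
      | succ i ih =>
        rw [pow_succ]
        nlinarith
    exact Nat.not_dvd_of_pos_of_lt (by positivity) hlt

theorem Nat.choose_add_three_mul (n i : ℕ) :
    (n + 2).choose (i + 3) * ((i + 2) * (i + 3)) = 2 * (n + 2).choose 2 * n.choose (i + 1) := by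
  have h₁ := Nat.add_one_mul_choose_eq (n + 1) (i + 2)
  have h₂ := Nat.add_one_mul_choose_eq n (i + 1)
  have h₃ := Nat.add_one_mul_choose_eq (n + 1) 1
  simp only [Nat.choose_one_right, add_assoc, Nat.reduceAdd] at h₁ h₂ h₃
  rw [mul_comm 2, ← h₃]
  linear_combination (n + 2) * -h₂ - (i + 2) * h₁

theorem five_pow_succ_dvd_choose {n v : ℕ} (hv : 5 ^ v ∣ (n + 2).choose 2) (i : ℕ) :
    5 ^ (v + 1) ∣ 5 ^ (i + 1) * (n + 2).choose (i + 3) := by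
  obtain ⟨t, s, hs, hts⟩ :=
    Nat.exists_eq_pow_mul_and_not_dvd (n := (i + 2) * (i + 3)) (by positivity) 5 (by norm_num)
  have hti : t ≤ i := by
    by_contra! hlt
    exact not_five_pow_dvd_mul i ((pow_dvd_pow 5 hlt).trans ⟨s, hts⟩)
  obtain ⟨d, rfl⟩ := Nat.exists_eq_add_of_le hti
  have hcop : Nat.Coprime (5 ^ (v + 1)) s :=
    Nat.Coprime.pow_left _ ((Nat.Prime.coprime_iff_not_dvd (by norm_num)).mpr hs)
  refine hcop.dvd_of_dvd_mul_right ?_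
  obtain ⟨c, hc⟩ := hv
  have hmul := Nat.choose_add_three_mul n (t + d)
  rw [hts, hc] at hmul
  refine ⟨2 * c * n.choose (t + d + 1) * 5 ^ d, ?_⟩
  rw [pow_succ 5 (t + d), pow_add 5 t d, pow_succ 5 v]
  linear_combination 5 * 5 ^ d * hmul

theorem IntegersSqrtNegEleven.im_α_pow_ne_one (n : ℕ) : (α ^ (4 * (n + 2) + 1)).im ≠ 1 := by
  intro h
  obtain ⟨v, s, hs, hvs⟩ :=
    Nat.exists_eq_pow_mul_and_not_dvd (n := (n + 2).choose 2)
      (Nat.choose_pos (by omega)).ne' 5 (by norm_num)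
  rw [im_α_pow_eq_sum, Finset.sum_range_succ'] at h
  have hβ : (β ^ (0 + 1)).im = -1 := by simp [β]
  rw [hβ] at h
  have hdvd : (5 : ℤ) ^ (v + 1) ∣ ∑ i ∈ Finset.range n,
      5 ^ (i + 1) * ((n + 2).choose (i + 1 + 2) : ℤ) * (β ^ (i + 1 + 1)).im := by
    refine Finset.dvd_sum fun i _ => Dvd.dvd.mul_right ?_ _
    exact_mod_cast five_pow_succ_dvd_choose ⟨s, hvs⟩ i
  have heq : ∑ i ∈ Finset.range n,
      5 ^ (i + 1) * ((n + 2).choose (i + 1 + 2) : ℤ) * (β ^ (i + 1 + 1)).im =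
        ((n + 2).choose 2 : ℤ) := by
    simp only [pow_zero, zero_add, one_mul] at h
    linarith
  rw [heq] at hdvd
  have hdvd' : 5 ^ (v + 1) ∣ 5 ^ v * s := hvs ▸ (by exact_mod_cast hdvd)
  rw [pow_succ] at hdvd'
  exact hs (Nat.dvd_of_mul_dvd_mul_left (by positivity) hdvd')

open IntegersSqrtNegEleven in
/-- The only powers of 3 with odd exponent of the form `x^2 + x + 3`
are `3` and `3^5 = 243`. -/
theorem three_pow_odd_eq (e : ℕ) (he : 0 < e) (hodd : Odd e) (x : ℕ)
    (h : 3 ^ e = x ^ 2 + x + 3) : 3 ^ e = 3 ∨ 3 ^ e = 243 := by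
  have him := im_α_pow_of_three_pow_eq he h
  have hα₁ : (α ^ 1).im = 1 := by simp [α]
  have hα₃ : (α ^ 3).im = -2 := by simp [α, pow_succ]
  obtain ⟨m, rfl | rfl⟩ : ∃ m, e = 4 * m + 1 ∨ e = 4 * m + 3 := by
    obtain ⟨k, rfl⟩ := hodd
    exact ⟨k / 2, by omega⟩
  · have hmod := im_α_pow_modEq m 1
    rw [hα₁, Int.ModEq] at hmod
    match m with
    | 0 => left; norm_num
    | 1 => right; norm_num
    | n + 2 => exact absurd (by omega) (im_α_pow_ne_one n)
  · have hmod := im_α_pow_modEq m 3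
    rw [hα₃, Int.ModEq] at hmod
    omega
end

section
/- Let q be a power of a prime, and suppose q = x^2 + x + a where x is a positive integer, a = 1 or a = 3, and a ≤ x. Then the fractional part of 2√q is strictly less than √3 − 1; equivalently, 2√q < 2x + √3. -/
/-- `15` is divisible by the distinct primes `3` and `5`, so it is not a prime power. -/
theorem not_isPrimePow_fifteen : ¬ IsPrimePow 15 := by
  intro h
  obtain ⟨p, -, hp⟩ := isPrimePow_iff_unique_prime_dvd.mp h
  have h3 := hp 3 ⟨by norm_num, by norm_num⟩
  have h5 := hp 5 ⟨by norm_num, by norm_num⟩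
  omega


/-- Proposition 4.3 (key inequality): if `q` is a prime power of the form
`q = x^2 + x + a` with `a = 1` or `a = 3` and `a ≤ x`, `x > 0`, then the
fractional part of `2√q` is strictly less than `√3 - 1`; equivalently,
`2√q < 2x + √3`. -/
theorem prop_4_3 (q x a : ℕ) (hq : IsPrimePow q) (hx : 0 < x)
    (ha : a = 1 ∨ a = 3) (hax : a ≤ x) (hqx : q = x ^ 2 + x + a) :
    Int.fract (2 * Real.sqrt q) < Real.sqrt 3 - 1 ∧
      2 * Real.sqrt q < 2 * x + Real.sqrt 3 := by
  have hq15 : q ≠ 15 := fun h => not_isPrimePow_fifteen (h ▸ hq)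
  have hqR : (q : ℝ) = x ^ 2 + x + a := by exact_mod_cast hqx
  have h3 : Real.sqrt 3 ^ 2 = 3 := Real.sq_sqrt (by norm_num)
  have h3_lower : 1.7 < Real.sqrt 3 := Real.lt_sqrt_of_sq_lt (by norm_num)
  have h3_upper : Real.sqrt 3 < 2 := by nlinarith
  have hxR : (1 : ℝ) ≤ x := by exact_mod_cast hx
  have hbound : 4 * (a : ℝ) - 3 < 4 * (Real.sqrt 3 - 1) * x := by
    rcases ha with rfl | rfl
    · push_cast
      nlinarith
    · have hx4 : 4 ≤ x := by
        rcases hax.eq_or_lt with rfl | h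
        · exact absurd hqx hq15
        · exact h
      have hx4R : (4 : ℝ) ≤ x := by exact_mod_cast hx4
      push_cast
      nlinarith
  have hupper : 2 * Real.sqrt q < 2 * x + Real.sqrt 3 := by
    have h : Real.sqrt q < x + Real.sqrt 3 / 2 := by
      rw [Real.sqrt_lt' (by positivity), hqR]
      nlinarith
    linarith
  have hlower : (2 * x + 1 : ℝ) ≤ 2 * Real.sqrt q := by
    have haR : (1 : ℝ) ≤ a := by
      rcases ha with rfl | rfl <;> norm_num
    have h : (x + 1 / 2 : ℝ) ≤ Real.sqrt q := by
      apply Real.le_sqrt_of_sq_le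
      rw [hqR]
      nlinarith
    linarith
  have hfloor : ⌊2 * Real.sqrt q⌋ = 2 * (x : ℤ) + 1 := by
    rw [Int.floor_eq_iff]
    push_cast
    constructor <;> linarith
  refine ⟨?_, hupper⟩
  rw [Int.fract, hfloor]
  push_cast
  linarith
end

section
/- Let p be a prime, e ≥ 1, and suppose q = p^e = x^2 + b where x is a positive integer, b = 1 or b = 2, b ≤ x, and q ≠ 2. Then p does not divide m = 2x and p does not divide m − 2 = 2(x − 1). -/
/-- An element of norm `3 ^ (n + 1)` in `ℤ[√-2]` that is not divisible by `3` and whose coordinates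
agree modulo `3` is, up to sign, a power of `1 + √-2`. -/
lemma eq_or_eq_neg_pow_of_norm_eq_three_pow (n : ℕ) (a b : ℤ) (hab : (3 : ℤ) ∣ a - b)
    (ha : ¬ (3 : ℤ) ∣ a) (h : a ^ 2 + 2 * b ^ 2 = 3 ^ (n + 1)) :
    (⟨1, 1⟩ : ℤ√(-2)) ^ (n + 1) = ⟨a, b⟩ ∨ (⟨1, 1⟩ : ℤ√(-2)) ^ (n + 1) = ⟨-a, -b⟩ := by
  induction n generalizing a b with
  | zero =>
    norm_num at h
    have h1 : a ≤ 1 := by nlinarith [sq_nonneg b]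
    have h2 : -1 ≤ a := by nlinarith [sq_nonneg b]
    have h3 : b ≤ 1 := by nlinarith [sq_nonneg a]
    have h4 : -1 ≤ b := by nlinarith [sq_nonneg a]
    interval_cases a <;> interval_cases b <;> simp_all
  | succ n ih =>
    obtain ⟨c, hc⟩ := hab
    -- `a + b√-2 = (1 + √-2) * ((b + c) + (-c)√-2)`
    obtain rfl : a = b + 3 * c := by linarith
    have h' : (b + c) ^ 2 + 2 * (-c) ^ 2 = 3 ^ (n + 1) := by
      rw [pow_succ 3 (n + 1)] at h
      linarith
    have hb : ¬ (3 : ℤ) ∣ b := fun hb => ha (dvd_add hb (dvd_mul_right _ _))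
    have hdiv : (3 : ℤ) ∣ b * (b + 2 * c) := by
      have : b * (b + 2 * c) = 3 * (3 ^ n - c ^ 2) := by
        rw [pow_succ 3 n] at h'
        linarith
      exact ⟨_, this⟩
    have hbc : (3 : ℤ) ∣ b + 2 * c := (Int.prime_three.dvd_or_dvd hdiv).resolve_left hb
    rcases ih (b + c) (-c) (by convert hbc using 1; ring) (by omega) h' with h1 | h1
    · left
      rw [pow_succ, h1]
      ext <;> simp <;> ring
    · right
      rw [pow_succ, h1]
      ext <;> simp <;> ring

/-- The `2`-adic expansion of the powers of `(1 + √-2) ^ 4`. -/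
lemma exists_pow_four_mul_eq (k : ℕ) (hk : 0 < k) :
    ∃ (j : ℕ) (A B : ℤ), (⟨1, 1⟩ : ℤ√(-2)) ^ (4 * k) =
      ⟨1 + 2 ^ (j + 2) * (2 * A), 2 ^ (j + 2) * (2 * B + 1)⟩ := by
  have h4 : (⟨1, 1⟩ : ℤ√(-2)) ^ 4 = ⟨-7, -4⟩ := by decide
  induction k using Nat.strong_induction_on with
  | _ k ih =>
    have heven : ∀ l, 0 < l → l < k → ∃ (j : ℕ) (A B : ℤ), (⟨1, 1⟩ : ℤ√(-2)) ^ (4 * (2 * l)) =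
        ⟨1 + 2 ^ (j + 3) * (2 * A), 2 ^ (j + 3) * (2 * B + 1)⟩ := by
      intro l hl hlk
      obtain ⟨j, A, B, h⟩ := ih l hlk hl
      refine ⟨j, A + 2 ^ j * ((2 * A) ^ 2 - 2 * (2 * B + 1) ^ 2),
        B + 2 ^ (j + 2) * A * (2 * B + 1), ?_⟩
      rw [show 4 * (2 * l) = 4 * l + 4 * l by ring, pow_add, h]
      ext <;> simp <;> ring
    rcases Nat.even_or_odd' k with ⟨l, rfl | rfl⟩
    · obtain ⟨j, A, B, h⟩ := heven l (by omega) (by omega)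
      exact ⟨j + 1, A, B, h⟩
    · rcases Nat.eq_zero_or_pos l with rfl | hl
      · exact ⟨0, -1, -1, by decide⟩
      · obtain ⟨j, A, B, h⟩ := heven l hl (by omega)
        refine ⟨0, -1 - 7 * 2 ^ (j + 1) * A + 2 ^ (j + 3) * (2 * B + 1),
          -1 - 2 ^ (j + 3) * A - 7 * 2 ^ j * (2 * B + 1), ?_⟩
        rw [show 4 * (2 * l + 1) = 4 * (2 * l) + 4 by ring, pow_add, h, h4]
        ext <;> simp <;> ring

/-- If `3 ^ e = x ^ 2 + 2` with `x ≡ 1` modulo `3`, then `x = 1`. -/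
lemma eq_one_of_three_pow_eq_sq_add_two (e x : ℕ) (hx : x % 3 = 1) (h : 3 ^ e = x ^ 2 + 2) :
    x = 1 := by
  have hodd : e % 2 = 1 := by
    by_contra hcon
    obtain ⟨k, rfl⟩ : 2 ∣ e := by omega
    have h1 : (3 ^ (2 * k)) % 4 = 1 := by
      rw [pow_mul, Nat.pow_mod]
      simp
    have h2 : x ^ 2 % 4 = 0 ∨ x ^ 2 % 4 = 1 := by
      have : x % 4 < 4 := Nat.mod_lt _ (by norm_num)
      rw [Nat.pow_mod]
      interval_cases x % 4 <;> simp
    omega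
  obtain ⟨n, rfl⟩ : ∃ n, e = n + 1 := ⟨e - 1, by omega⟩
  have hpow := eq_or_eq_neg_pow_of_norm_eq_three_pow n x 1 (by omega) (by omega)
    (by rw [one_pow, mul_one]; exact_mod_cast h.symm)
  obtain ⟨k, hk⟩ : ∃ k, n + 1 = 4 * k + 1 ∨ n + 1 = 4 * k + 3 := ⟨(n + 1) / 4, by omega⟩
  have him : ((⟨1, 1⟩ : ℤ√(-2)) ^ (n + 1)).im = 1 ∨ ((⟨1, 1⟩ : ℤ√(-2)) ^ (n + 1)).im = -1 := by
    rcases hpow with h | h <;> simp [h]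
  rcases Nat.eq_zero_or_pos k with rfl | hk0
  · rcases hk with hk | hk <;> rw [hk] at h <;> norm_num at h
    · nlinarith
    · have : x ≤ 5 := by nlinarith
      interval_cases x <;> omega
  · exfalso
    obtain ⟨j, A, B, hAB⟩ := exists_pow_four_mul_eq k hk0
    have hα : (⟨1, 1⟩ : ℤ√(-2)) ^ 3 = ⟨-5, 1⟩ := by decide
    have key : ∀ C : ℤ, 1 + 2 ^ (j + 2) * (2 * C + 1) ≠ 1 ∧
        1 + 2 ^ (j + 2) * (2 * C + 1) ≠ -1 := by
      intro C
      refine ⟨fun hC => ?_, fun hC => ?_⟩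
      · have : (2 : ℤ) ^ (j + 2) * (2 * C + 1) = 0 := by linarith
        rcases mul_eq_zero.mp this with h0 | h0
        · exact pow_ne_zero _ two_ne_zero h0
        · omega
      · have : 4 * ((2 : ℤ) ^ j * (2 * C + 1)) = -2 := by
          rw [pow_add] at hC
          linarith
        omega
    rcases hk with hk | hk <;> rw [hk, pow_add, hAB] at him
    · have := key (A + B)
      simp only [pow_one, Zsqrtd.im_mul] at him
      rcases him with him | him
      · exact this.1 (by linarith)
      · exact this.2 (by linarith)
    · have := key (A - 5 * B - 3)
      simp only [hα, Zsqrtd.im_mul] at him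
      rcases him with him | him
      · exact this.1 (by linarith)
      · exact this.2 (by linarith)

/-- A power of two of the form `x ^ 2 + 1` or `x ^ 2 + 2` is at most `2`. -/
lemma two_pow_eq_two_of_eq_sq_add (e x b : ℕ) (he : 1 ≤ e) (hb : b = 1 ∨ b = 2)
    (h : 2 ^ e = x ^ 2 + b) : 2 ^ e = 2 := by
  obtain ⟨n, rfl⟩ : ∃ n, e = n + 1 := ⟨e - 1, by omega⟩
  rcases n with _ | n
  · rfl
  · have h1 : 2 ^ (n + 1 + 1) = 4 * 2 ^ n := by ring
    have h2 : x ^ 2 % 4 = 0 ∨ x ^ 2 % 4 = 1 := by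
      have : x % 4 < 4 := Nat.mod_lt _ (by norm_num)
      rw [Nat.pow_mod]
      interval_cases x % 4 <;> simp
    omega

/-- Proposition 4.8: If `q = p^e = x^2 + b` with `b = 1` or `b = 2`, `b ≤ x`,
`x > 0`, and `q ≠ 2`, then `p` divides neither `m = 2x` nor `m - 2 = 2(x-1)`. -/
theorem prop_4_8 (p e q x b : ℕ) (hp : p.Prime) (he : 1 ≤ e) (hq : q = p ^ e)
    (hx : 0 < x) (hb : b = 1 ∨ b = 2) (hbx : b ≤ x) (hqx : q = x ^ 2 + b)
    (hq2 : q ≠ 2) : ¬ p ∣ 2 * x ∧ ¬ p ∣ 2 * (x - 1) := by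
  subst hq
  have hp2 : p ≠ 2 := by
    rintro rfl
    exact hq2 (two_pow_eq_two_of_eq_sq_add e x b he hb hqx)
  have hpdvd2 : ¬ p ∣ 2 := fun h => hp2 ((Nat.prime_dvd_prime_iff_eq hp Nat.prime_two).mp h)
  have hpq : p ∣ x ^ 2 + b := hqx ▸ dvd_pow_self p (by omega)
  refine ⟨fun h => ?_, fun h => ?_⟩
  · have hpx : p ∣ x := (hp.dvd_mul.mp h).resolve_left hpdvd2
    have hpb : p ∣ b := (Nat.dvd_add_right (dvd_pow hpx two_ne_zero)).mp hpq
    rcases hb with rfl | rfl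
    · exact hp.one_lt.ne' (Nat.dvd_one.mp hpb)
    · exact hpdvd2 hpb
  · have hpx : p ∣ x - 1 := (hp.dvd_mul.mp h).resolve_left hpdvd2
    obtain ⟨y, rfl⟩ : ∃ y, x = y + 1 := ⟨x - 1, by omega⟩
    rw [Nat.add_sub_cancel] at hpx
    have hpb : p ∣ b + 1 := by
      rw [show (y + 1) ^ 2 + b = y * (y + 2) + (b + 1) by ring] at hpq
      exact (Nat.dvd_add_right (hpx.mul_right _)).mp hpq
    rcases hb with rfl | rfl
    · exact hpdvd2 hpb
    · obtain rfl : p = 3 := (Nat.prime_dvd_prime_iff_eq hp Nat.prime_three).mp hpb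
      have := eq_one_of_three_pow_eq_sq_add_two e (y + 1) (by omega) hqx
      omega
end

section
/- Let p be a prime, e ≥ 1, and suppose q = p^e = x^2 + x + a where x is a positive integer, a = 1 or a = 3, a ≤ x, and q ≠ 3 and q ≠ 243. Then p does not divide m − 1 = 2x. -/
/-- The Lucas sequence `u (n + 2) = u (n + 1) - 3 * u n`, where `u n` is the coefficient of `α` in
`α ^ n` for `α = (1 + √-11) / 2`. -/
def lucasOneThree : ℕ → ℤ
  | 0 => 0
  | 1 => 1
  | n + 2 => lucasOneThree (n + 1) - 3 * lucasOneThree n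

theorem lucasOneThree_add_two (n : ℕ) :
    lucasOneThree (n + 2) = lucasOneThree (n + 1) - 3 * lucasOneThree n := rfl

theorem lucasOneThree_add_six (n : ℕ) :
    lucasOneThree (n + 6) = -3 * lucasOneThree n + 16 * lucasOneThree (n + 1) := by
  have h0 := lucasOneThree_add_two n
  have h1 := lucasOneThree_add_two (n + 1)
  have h2 := lucasOneThree_add_two (n + 2)
  have h3 := lucasOneThree_add_two (n + 3)
  have h4 := lucasOneThree_add_two (n + 4)
  linarith

/-- An element of norm `3 ^ n` in `ℤ[α]` that is not divisible by the conjugate of `α` is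
`± α ^ n`. -/
theorem eq_lucasOneThree_of_norm_eq (n : ℕ) (w z : ℤ) (h : w ^ 2 - w * z + 3 * z ^ 2 = 3 ^ n)
    (hw : ¬ 3 ∣ w) :
    (z = lucasOneThree n ∧ w = lucasOneThree (n + 1)) ∨
      (z = -lucasOneThree n ∧ w = -lucasOneThree (n + 1)) := by
  induction n generalizing w z with
  | zero =>
    have hz : z = 0 := by
      by_contra hz
      have : 0 < z ^ 2 := by positivity
      nlinarith [sq_nonneg (2 * w - z)]
    subst hz
    have hw1 : w = 1 ∨ w = -1 := by simpa using h
    simpa [lucasOneThree] using hw1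
  | succ n ih =>
    have hdvd : (3 : ℤ) ∣ w * (w - z) := ⟨3 ^ n - z ^ 2, by rw [pow_succ (3 : ℤ)] at h; linarith⟩
    obtain ⟨t, ht⟩ := (Int.prime_three.dvd_or_dvd hdvd).resolve_left hw
    obtain rfl : w = z + 3 * t := by linarith
    have hz : ¬ (3 : ℤ) ∣ z := by omega
    have hnorm : z ^ 2 - z * (-t) + 3 * (-t) ^ 2 = 3 ^ n := by
      rw [pow_succ (3 : ℤ)] at h
      linarith
    have := lucasOneThree_add_two n
    rcases ih z (-t) hnorm hz with ⟨h1, h2⟩ | ⟨h1, h2⟩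
    · exact Or.inl ⟨h2, by linarith⟩
    · exact Or.inr ⟨h2, by linarith⟩

theorem exists_lucasOneThree_add_six_mul_two_pow (j : ℕ) :
    ∃ a b : ℤ, ∀ n, lucasOneThree (n + 6 * 2 ^ j) =
      (1 + 2 ^ (j + 2) * (2 * a + 1)) * lucasOneThree n +
        2 ^ (j + 3) * b * lucasOneThree (n + 1) := by
  induction j with
  | zero => exact ⟨-1, 2, fun n => by rw [pow_zero, mul_one, lucasOneThree_add_six]; ring⟩
  | succ j ih =>
    obtain ⟨a, b, h⟩ := ih
    refine ⟨a + 2 ^ j * (2 * a + 1) ^ 2 - 3 * 2 ^ (j + 2) * b ^ 2,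
      (1 + 2 ^ (j + 2) * (2 * a + 1)) * b + 2 ^ (j + 2) * b ^ 2, fun n => ?_⟩
    have h1 := h (n + 1)
    rw [show n + 6 * 2 ^ (j + 1) = n + 6 * 2 ^ j + 6 * 2 ^ j by ring, h,
      show n + 6 * 2 ^ j + 1 = n + 1 + 6 * 2 ^ j by ring, h, h1, lucasOneThree_add_two]
    ring

theorem lucasOneThree_add_mul_modEq (j n i : ℕ) :
    lucasOneThree (n + 6 * 2 ^ j * i) ≡ lucasOneThree n [ZMOD 2 ^ (j + 2)] := by
  induction i with
  | zero => rfl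
  | succ i ih =>
    obtain ⟨a, b, h⟩ := exists_lucasOneThree_add_six_mul_two_pow j
    refine Int.ModEq.trans ?_ ih
    rw [mul_add_one, ← add_assoc, h]
    refine (Int.modEq_iff_dvd.mpr ⟨(2 * a + 1) * lucasOneThree (n + 6 * 2 ^ j * i) +
      2 * b * lucasOneThree (n + 6 * 2 ^ j * i + 1), ?_⟩).symm
    ring

theorem lucasOneThree_add_six_mul_ne {n k : ℕ} (hn : Odd (lucasOneThree n)) (hk : k ≠ 0) :
    lucasOneThree (n + 6 * k) ≠ lucasOneThree n := by
  intro heq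
  obtain ⟨j, m, ⟨i, rfl⟩, rfl⟩ := Nat.exists_eq_two_pow_mul_odd hk
  obtain ⟨a, b, h⟩ := exists_lucasOneThree_add_six_mul_two_pow j
  have hmod := lucasOneThree_add_mul_modEq (j + 1) (n + 6 * 2 ^ j) i
  rw [show n + 6 * 2 ^ j + 6 * 2 ^ (j + 1) * i = n + 6 * (2 ^ j * (2 * i + 1)) by ring, heq, h]
    at hmod
  obtain ⟨c, hc⟩ := hmod.dvd
  obtain ⟨d, hd⟩ := hn
  have hpos : (2 : ℤ) ^ (j + 2) ≠ 0 := by positivity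
  have hcancel : (2 * a + 1) * lucasOneThree n + 2 * b * lucasOneThree (n + 1) = 2 * c := by
    apply mul_left_cancel₀ hpos
    linear_combination hc
  rw [hd] at hcancel
  have : 2 * (c - 2 * a * d - a - d - b * lucasOneThree (n + 1)) = 1 := by
    linear_combination -hcancel
  omega

theorem eq_one_or_five_of_lucasOneThree_eq {n : ℕ} (hn : Odd n)
    (h : lucasOneThree n = 1 ∨ lucasOneThree n = -1) : n = 1 ∨ n = 5 := by
  have u1 : lucasOneThree 1 = 1 := rfl
  have u3 : lucasOneThree 3 = -2 := rfl
  have u5 : lucasOneThree 5 = 1 := rfl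
  obtain ⟨k, hk⟩ : ∃ k, n = 1 + 6 * k ∨ n = 3 + 6 * k ∨ n = 5 + 6 * k :=
    ⟨n / 6, by obtain ⟨i, rfl⟩ := hn; omega⟩
  have hmod (r : ℕ) : lucasOneThree (r + 6 * k) % 4 = lucasOneThree r % 4 := by
    simpa [Int.ModEq] using lucasOneThree_add_mul_modEq 0 r k
  rcases hk with rfl | rfl | rfl
  · have := hmod 1
    by_cases hk : k = 0
    · omega
    · have := lucasOneThree_add_six_mul_ne (n := 1) (by decide) hk
      omega
  · have := hmod 3
    omega
  · have := hmod 5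
    by_cases hk : k = 0
    · omega
    · have := lucasOneThree_add_six_mul_ne (n := 5) (by decide) hk
      omega

theorem eq_one_or_five_of_three_pow_eq {e x : ℕ} (hx : 3 ≤ x) (h3 : 3 ∣ x)
    (h : 3 ^ e = x ^ 2 + x + 3) : e = 1 ∨ e = 5 := by
  have hodd : Odd e := by
    by_contra he
    obtain ⟨k, rfl⟩ := Nat.not_odd_iff_even.mp he
    rw [pow_add] at h
    have h1 : x < 3 ^ k := lt_of_mul_self_lt_mul_self₀ (Nat.zero_le _) (by nlinarith)
    have h2 : 3 ^ k < x + 1 := lt_of_mul_self_lt_mul_self₀ (Nat.zero_le _) (by nlinarith)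
    omega
  have hZ : (3 : ℤ) ^ e = x ^ 2 + x + 3 := by exact_mod_cast h
  have := eq_lucasOneThree_of_norm_eq e (x + 1) 1 (by rw [hZ]; ring) (by omega)
  exact eq_one_or_five_of_lucasOneThree_eq hodd (by omega)

/-- Coprimality claim from Proposition 4.6: if `q = p^e = x^2 + x + a` with
`a = 1` or `a = 3`, `a ≤ x`, `x > 0`, and `q ≠ 3` and `q ≠ 243`, then
`p` does not divide `m - 1 = 2x`. -/
theorem prop_4_6_coprime (p e q x a : ℕ) (hp : p.Prime) (he : 1 ≤ e)
    (hq : q = p ^ e) (hx : 0 < x) (ha : a = 1 ∨ a = 3) (hax : a ≤ x)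
    (hqx : q = x ^ 2 + x + a) (hq3 : q ≠ 3) (hq243 : q ≠ 243) :
    ¬ p ∣ 2 * x := by
  intro hdvd
  have hpq : p ∣ x * (x + 1) + a := by
    rw [show x * (x + 1) + a = p ^ e by rw [← hq, hqx]; ring]
    exact dvd_pow_self p (by omega)
  have hpx : p ∣ x := by
    refine (hp.dvd_mul.mp hdvd).resolve_left fun h2 => ?_
    rw [(Nat.prime_dvd_prime_iff_eq hp Nat.prime_two).mp h2] at hpq
    have := (Nat.even_mul_succ_self x).two_dvd
    omega
  have hpa : p ∣ a := (Nat.dvd_add_right (hpx.mul_right _)).mp hpq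
  rcases ha with rfl | rfl
  · exact hp.one_lt.ne' (Nat.dvd_one.mp hpa)
  · obtain rfl := (Nat.prime_dvd_prime_iff_eq hp Nat.prime_three).mp hpa
    rcases eq_one_or_five_of_three_pow_eq hax hpx (hq.symm.trans hqx) with rfl | rfl
    · exact hq3 (by simpa using hq)
    · exact hq243 (by simpa using hq)
end
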